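/- Let S ⊆ ℝ² satisfy (H1). Then S is either a singleton, or a 1-dimensional manifold of class C^{1,1} (possibly with boundary): that is, near each of its points S coincides, in suitable orthonormal coordinates, with the graph of a C¹ function with Lipschitz derivative, defined on an open interval (at interior points of the manifold) or on a half-open interval (at boundary points of the manifold). -/

import Mathlib

open Metric Set Real

noncomputable section

abbrev E2 := EuclideanSpace ℝ (Fin 2)

/-- The point of the Euclidean plane with coordinates `(a, b)`. -/
def pt (a b : ℝ) : E2 := (EuclideanSpace.equiv (Fin 2) ℝ).symm ![a, b]

/-- `S` is, near `p`, in suitable orthonormal coordinates (i.e. up to a rigid motion `e`),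
the graph of a `C¹` function with Lipschitz derivative over an interval `I`, which is either
open (interior points of the manifold) or half-open (boundary points of the manifold). -/
def IsC11GraphAt (S : Set E2) (p : E2) : Prop :=
  ∃ (e : E2 ≃ᵃⁱ[ℝ] E2) (U : Set E2) (g : ℝ → ℝ) (I : Set ℝ),
    IsOpen U ∧ p ∈ U ∧
    ((∃ a b : ℝ, a < b ∧ I = Set.Ioo a b) ∨ (∃ a b : ℝ, a < b ∧ I = Set.Ico a b)) ∧
    ContDiff ℝ 1 g ∧ (∃ K : NNReal, LipschitzWith K (deriv g)) ∧
    e '' (S ∩ U) = (fun t => pt t (g t)) '' I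

open Filter Topology

theorem exists_steep_ascent {S : Set E2} (hne : S.Nonempty) (hcl : IsClosed S) {y : E2}
    (hy : 0 < infDist y S) (hd : DifferentiableAt ℝ (fun x => infDist x S) y)
    {ε η : ℝ} (hε : 0 < ε) (hη : 0 < η) :
    ∃ z, 0 < dist z y ∧ dist z y < η ∧
      infDist y S + (1 - ε) * dist z y < infDist z S := by
  obtain ⟨p, hp, hpy⟩ := hcl.exists_infDist_eq_dist hne y
  set D := infDist y S with hD
  set v : E2 := D⁻¹ • (y - p) with hv
  have hyp : y - p = D • v := by rw [hv, smul_smul, mul_inv_cancel₀ hy.ne', one_smul]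
  have hv1 : ‖v‖ = 1 := by
    rw [hv, norm_smul, ← dist_eq_norm, ← hpy, norm_inv, Real.norm_of_nonneg hy.le,
      inv_mul_cancel₀ hy.ne']
  set φ : ℝ → ℝ := fun t => infDist (y + t • v) S with hφ
  have hder : HasDerivAt φ (fderiv ℝ (fun x => infDist x S) y v) 0 := by
    have h1 : HasDerivAt (fun t : ℝ => y + t • v) v 0 := by
      simpa using ((hasDerivAt_id (0 : ℝ)).smul_const v).const_add y
    have h2 : HasFDerivAt (fun x => infDist x S) (fderiv ℝ (fun x => infDist x S) y)
        (y + (0 : ℝ) • v) := by simpa using hd.hasFDerivAt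
    exact h2.comp_hasDerivAt 0 h1
  have hleft : HasDerivWithinAt φ 1 (Icc (-D) 0) 0 := by
    have h1 : HasDerivWithinAt (fun t : ℝ => D + t) 1 (Icc (-D) 0) 0 :=
      ((hasDerivAt_id (0 : ℝ)).const_add D).hasDerivWithinAt
    refine h1.congr_of_mem (fun t ht => ?_) ⟨by linarith, le_rfl⟩
    apply le_antisymm
    · refine (infDist_le_dist_of_mem hp).trans ?_
      have : y + t • v - p = (D + t) • v := by
        rw [add_smul, ← hyp]; abel
      rw [dist_eq_norm, this, norm_smul, hv1, mul_one, Real.norm_of_nonneg (by linarith [ht.1])]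
    · have := infDist_le_infDist_add_dist (s := S) (x := y) (y := y + t • v)
      rw [dist_eq_norm, show y - (y + t • v) = (-t) • v by rw [neg_smul]; abel, norm_smul, hv1,
        mul_one, Real.norm_of_nonneg (by linarith [ht.2])] at this
      simp only [hφ]; linarith
  have hone : fderiv ℝ (fun x => infDist x S) y v = 1 :=
    UniqueDiffWithinAt.eq_deriv _ (uniqueDiffOn_Icc (by linarith) 0 ⟨by linarith, le_rfl⟩)
      hder.hasDerivWithinAt hleft
  rw [hone, hasDerivAt_iff_tendsto_slope_zero] at hder
  have h3 : ∀ᶠ t in 𝓝[>] (0 : ℝ), 1 - ε < t⁻¹ • (φ (0 + t) - φ 0) :=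
    (hder.mono_left (nhdsWithin_mono _ (fun t (ht : 0 < t) => ht.ne'))).eventually
      (lt_mem_nhds (by linarith))
  have h4 : ∀ᶠ t in 𝓝[>] (0 : ℝ), t ∈ Ioo 0 η := Ioo_mem_nhdsGT hη
  obtain ⟨t, ht, ht0, htη⟩ := (h3.and h4).exists
  have hdist : dist (y + t • v) y = t := by
    rw [dist_eq_norm, add_sub_cancel_left, norm_smul, hv1, mul_one, Real.norm_of_nonneg ht0.le]
  refine ⟨y + t • v, by rwa [hdist], by rwa [hdist], ?_⟩
  rw [hdist]
  simp only [hφ, zero_add, zero_smul, add_zero, smul_eq_mul] at ht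
  rw [inv_mul_eq_div, lt_div_iff₀ ht0] at ht
  linarith

theorem exists_infDist_ge_add {S : Set E2} (hne : S.Nonempty) (hcl : IsClosed S) {r s : ℝ}
    (hd : ∀ y, 0 < infDist y S → infDist y S < r → DifferentiableAt ℝ (fun x => infDist x S) y)
    {x : E2} (hx : 0 < infDist x S) (hs : 0 ≤ s) (hxs : infDist x S + s < r) :
    ∃ y, dist y x ≤ s ∧ infDist x S + s ≤ infDist y S := by
  have hB : (closedBall x s).Nonempty := ⟨x, mem_closedBall_self hs⟩
  obtain ⟨y, hy, hmax⟩ := (isCompact_closedBall x s).exists_isMaxOn hB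
    (continuous_infDist_pt S).continuousOn
  refine ⟨y, hy, ?_⟩
  have key : ∀ ε ∈ Ioo (0 : ℝ) 1, infDist x S + (1 - ε) * s ≤ infDist y S := by
    rintro ε ⟨hε, hε1⟩
    obtain ⟨z, hz, hzmax⟩ := (isCompact_closedBall x s).exists_isMaxOn hB
      (f := fun y => infDist y S - (1 - ε) * dist y x)
      ((continuous_infDist_pt S).sub (by fun_prop)).continuousOn
    have hzx : infDist x S ≤ infDist z S - (1 - ε) * dist z x := by
      simpa using hzmax (mem_closedBall_self hs)
    have hzs : dist z x = s := by
      refine le_antisymm hz (not_lt.1 fun hlt => ?_)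
      have h0 : 0 ≤ (1 - ε) * dist z x := mul_nonneg (by linarith) dist_nonneg
      have hzr : infDist z S < r := by
        have := infDist_le_infDist_add_dist (s := S) (x := z) (y := x)
        linarith
      obtain ⟨u, hu0, hu1, hu2⟩ := exists_steep_ascent hne hcl (by linarith)
        (hd z (by linarith) hzr) hε (sub_pos.2 hlt)
      have htri := dist_triangle u z x
      have : infDist u S - (1 - ε) * dist u x ≤ infDist z S - (1 - ε) * dist z x :=
        hzmax (mem_closedBall.2 (by linarith))
      nlinarith
    rw [hzs] at hzx
    have : infDist z S ≤ infDist y S := hmax hz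
    linarith
  have hlim : Tendsto (fun ε : ℝ => infDist x S + (1 - ε) * s) (𝓝[>] 0) (𝓝 (infDist x S + s)) := by
    have : ContinuousAt (fun ε : ℝ => infDist x S + (1 - ε) * s) 0 := by fun_prop
    simpa [ContinuousAt] using this.tendsto.mono_left nhdsWithin_le_nhds
  exact le_of_tendsto hlim (by filter_upwards [Ioo_mem_nhdsGT one_pos] with ε hε using key ε hε)

/-- Federer's inequality for sets of reach at least `ρ`: if `p` is a nearest point of `S` to some
`x` with `0 < infDist x S < ρ`, then `S` misses the open ball of radius `ρ` that touches `S` at `p`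
in the direction `x - p`. -/
def ProximalIneq (S : Set E2) (ρ : ℝ) : Prop :=
  ∀ x, 0 < infDist x S → infDist x S < ρ → ∀ p ∈ S, infDist x S = dist x p → ∀ q ∈ S,
    2 * ρ * inner ℝ (x - p) (q - p) ≤ infDist x S * ‖q - p‖ ^ 2

theorem proximalIneq_of_differentiable {S : Set E2} (hne : S.Nonempty) (hcl : IsClosed S)
    {r ρ : ℝ} (hρ : ρ < r)
    (hd : ∀ y, 0 < infDist y S → infDist y S < r →
      DifferentiableAt ℝ (fun x => infDist x S) y) : ProximalIneq S ρ := by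
  intro x hx hxρ p hp hpx q hq
  obtain ⟨y, hyx, hy⟩ := exists_infDist_ge_add hne hcl hd hx (s := ρ - infDist x S)
    (by linarith) (by linarith)
  set D := infDist x S with hD
  have hyp : ρ ≤ ‖y - p‖ := by
    have := infDist_le_dist_of_mem (x := y) hp
    rw [dist_eq_norm] at this; linarith
  have hyq : ρ ≤ ‖y - q‖ := by
    have := infDist_le_dist_of_mem (x := y) hq
    rw [dist_eq_norm] at this; linarith
  rw [dist_eq_norm] at hyx hpx
  have e1 : ‖y - p‖ ^ 2 = ‖y - x‖ ^ 2 + 2 * inner ℝ (y - x) (x - p) + ‖x - p‖ ^ 2 := by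
    rw [← norm_add_sq_real]; congr 2; abel
  have hin : (ρ - D) * D ≤ inner ℝ (y - x) (x - p) := by
    have := norm_nonneg (y - x)
    rw [← hpx] at e1
    nlinarith
  have hcol : D • (y - x) - (ρ - D) • (x - p) = 0 := by
    rw [← norm_eq_zero, ← sq_eq_zero_iff]
    refine le_antisymm ?_ (sq_nonneg _)
    rw [norm_sub_sq_real, norm_smul, norm_smul, inner_smul_left, inner_smul_right, ← hpx,
      Real.norm_of_nonneg hx.le, Real.norm_of_nonneg (by linarith : 0 ≤ ρ - D)]
    simp only [conj_trivial]
    have h1 : ‖y - x‖ ^ 2 ≤ (ρ - D) ^ 2 := pow_le_pow_left₀ (norm_nonneg _) hyx 2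
    have h2 := mul_le_mul_of_nonneg_left h1 (sq_nonneg D)
    have h3 := mul_le_mul_of_nonneg_left hin
      (mul_nonneg hx.le (by linarith : 0 ≤ ρ - D))
    nlinarith
  have hDy : D • (y - p) = ρ • (x - p) := by
    have : D • (y - p) - ρ • (x - p) = D • (y - x) - (ρ - D) • (x - p) := by module
    rwa [hcol, sub_eq_zero] at this
  have e2 : ‖y - q‖ ^ 2 = ‖y - p‖ ^ 2 - 2 * inner ℝ (y - p) (q - p) + ‖q - p‖ ^ 2 := by
    rw [← norm_sub_sq_real]; congr 2; abel
  have e3 : D * inner ℝ (y - p) (q - p) = ρ * inner ℝ (x - p) (q - p) := by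
    rw [← real_inner_smul_left, hDy, real_inner_smul_left]
  have e4 : ‖y - p‖ = ρ := by
    have := congrArg norm hDy
    rw [norm_smul, norm_smul, ← hpx, Real.norm_of_nonneg hx.le,
      Real.norm_of_nonneg (by linarith : 0 ≤ ρ), mul_comm ρ] at this
    exact mul_left_cancel₀ hx.ne' this
  have h5 : 2 * inner ℝ (y - p) (q - p) ≤ ‖q - p‖ ^ 2 := by
    rw [e4] at e2; nlinarith
  nlinarith

theorem ProximalIneq.infDist_segment_le {S : Set E2} {ρ : ℝ} (hcl : IsClosed S)
    (hS : ProximalIneq S ρ) {a b : E2} (ha : a ∈ S) (hb : b ∈ S) (hab : ‖b - a‖ < ρ)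
    {l : ℝ} (hl : l ∈ Icc (0 : ℝ) 1) :
    infDist (a + l • (b - a)) S ≤ l * (‖b - a‖ ^ 2 / ρ) := by
  have hρ : 0 < ρ := (norm_nonneg _).trans_lt hab
  set m := a + l • (b - a) with hm
  obtain ⟨p, hp, hpm⟩ := hcl.exists_infDist_eq_dist ⟨a, ha⟩ m
  set D := infDist m S with hD
  rcases (infDist_nonneg : 0 ≤ D).eq_or_lt with h0 | h0
  · exact h0.ge.trans (mul_nonneg hl.1 (by positivity))
  have hDρ : D < ρ := by
    refine (infDist_le_dist_of_mem ha).trans_lt (lt_of_le_of_lt ?_ hab)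
    rw [dist_eq_norm, hm, add_sub_cancel_left, norm_smul, Real.norm_of_nonneg hl.1]
    exact mul_le_of_le_one_left (norm_nonneg _) hl.2
  have h1 := hS m h0 hDρ p hp hpm a ha
  have h2 := hS m h0 hDρ p hp hpm b hb
  rw [dist_eq_norm] at hpm
  have e1 : a - p = (m - p) - l • (b - a) := by rw [hm]; module
  have e2 : b - p = (m - p) + (1 - l) • (b - a) := by rw [hm]; module
  rw [e1, norm_sub_sq_real, inner_sub_right, real_inner_smul_right, norm_smul,
    real_inner_self_eq_norm_sq, ← hD, ← hpm, mul_pow, Real.norm_eq_abs, sq_abs] at h1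
  rw [e2, norm_add_sq_real, inner_add_right, real_inner_smul_right, norm_smul,
    real_inner_self_eq_norm_sq, ← hD, ← hpm, mul_pow, Real.norm_eq_abs, sq_abs] at h2
  have h3 : 2 * ρ * D ^ 2 ≤ D * (D ^ 2 + l * (1 - l) * ‖b - a‖ ^ 2) := by
    have := add_le_add (mul_le_mul_of_nonneg_left h1 (sub_nonneg.2 hl.2))
      (mul_le_mul_of_nonneg_left h2 hl.1)
    nlinarith
  have h4 : 2 * ρ * D ≤ D ^ 2 + l * (1 - l) * ‖b - a‖ ^ 2 := by
    refine le_of_mul_le_mul_left ?_ h0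
    linarith
  rw [mul_div_assoc', le_div_iff₀ hρ]
  have h5 : 0 ≤ l * l * ‖b - a‖ ^ 2 := mul_nonneg (mul_self_nonneg l) (sq_nonneg _)
  nlinarith

theorem ProximalIneq.exists_normal {S : Set E2} {ρ : ℝ} (hρ : 0 < ρ) (hcl : IsClosed S)
    (hS : ProximalIneq S ρ) (hint : interior S = ∅) {a : E2} (ha : a ∈ S) :
    ∃ v : E2, ‖v‖ = 1 ∧ ∀ q ∈ S, 2 * ρ * inner ℝ v (q - a) ≤ ‖q - a‖ ^ 2 := by
  have hex : ∀ n : ℕ, ∃ p ∈ S, ∃ v : E2, dist p a ≤ 2 * (1 / ((n : ℝ) + 1)) ∧ ‖v‖ = 1 ∧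
      ∀ q ∈ S, 2 * ρ * inner ℝ v (q - p) ≤ ‖q - p‖ ^ 2 := by
    intro n
    have hpos : 0 < min ρ (1 / ((n : ℝ) + 1)) := lt_min hρ (by positivity)
    have hnot : ¬ ball a (min ρ (1 / ((n : ℝ) + 1))) ⊆ S := fun hsub => by
      have : a ∈ interior S := mem_interior.2 ⟨_, hsub, isOpen_ball, mem_ball_self hpos⟩
      simp [hint] at this
    obtain ⟨x, hx, hxS⟩ := not_subset.1 hnot
    obtain ⟨p, hp, hpx⟩ := hcl.exists_infDist_eq_dist ⟨a, ha⟩ x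
    have hx0 : 0 < infDist x S := (hcl.notMem_iff_infDist_pos ⟨a, ha⟩).1 hxS
    have hxa : infDist x S ≤ dist x a := infDist_le_dist_of_mem ha
    have hx1 : dist x a < ρ := (mem_ball.1 hx).trans_le (min_le_left _ _)
    have hx2 : dist x a < 1 / ((n : ℝ) + 1) := (mem_ball.1 hx).trans_le (min_le_right _ _)
    refine ⟨p, hp, (infDist x S)⁻¹ • (x - p), ?_, ?_, fun q hq => ?_⟩
    · have := dist_triangle p x a
      rw [dist_comm p x] at this
      linarith
    · rw [norm_smul, ← dist_eq_norm, ← hpx, norm_inv, Real.norm_of_nonneg hx0.le,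
        inv_mul_cancel₀ hx0.ne']
    · have := hS x hx0 (by linarith) p hp hpx q hq
      rw [real_inner_smul_left, mul_left_comm, inv_mul_le_iff₀ hx0]
      exact this
  choose p hp v hpa hv hq using hex
  obtain ⟨w, hw, φ, hφ, hlim⟩ := (isCompact_sphere (0 : E2) 1).tendsto_subseq (x := v)
    (fun n => by simp [hv n])
  have hpl : Tendsto p atTop (𝓝 a) := by
    rw [tendsto_iff_dist_tendsto_zero]
    refine squeeze_zero (fun _ => dist_nonneg) hpa ?_
    simpa using tendsto_one_div_add_atTop_nhds_zero_nat.const_mul (2 : ℝ)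
  have hpl' := hpl.comp hφ.tendsto_atTop
  refine ⟨w, by simpa using hw, fun q hqS => ?_⟩
  refine le_of_tendsto_of_tendsto' ((hlim.inner (hpl'.const_sub q)).const_mul (2 * ρ))
    ((hpl'.const_sub q).norm.pow 2) fun n => hq _ q hqS

/-- The derivable tangent cone: limits `t → 0⁺` of difference quotients of curves in `S`. -/
def derivableCone (S : Set E2) (a : E2) : Set E2 :=
  {w | ∃ s : ℝ → E2, (∀ t, s t ∈ S) ∧ Tendsto (fun t => t⁻¹ • (s t - a)) (𝓝[>] 0) (𝓝 w)}

theorem smul_mem_derivableCone {S : Set E2} {a w : E2} (hw : w ∈ derivableCone S a) {c : ℝ}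
    (hc : 0 < c) : c • w ∈ derivableCone S a := by
  obtain ⟨s, hs, hlim⟩ := hw
  refine ⟨fun t => s (c * t), fun t => hs _, ?_⟩
  have hmul : Tendsto (fun t : ℝ => c * t) (𝓝[>] 0) (𝓝[>] 0) := by
    refine tendsto_nhdsWithin_iff.2 ⟨?_, ?_⟩
    · have : ContinuousAt (fun t : ℝ => c * t) 0 := by fun_prop
      simpa [ContinuousAt] using this.tendsto.mono_left nhdsWithin_le_nhds
    · filter_upwards [self_mem_nhdsWithin] with t ht using mul_pos hc ht
  refine ((hlim.comp hmul).const_smul c).congr fun t => ?_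
  simp only [Function.comp, smul_smul, mul_inv, mul_inv_cancel_left₀ hc.ne']

theorem mem_derivableCone_of_infDist_le {S : Set E2} (hne : S.Nonempty) (hcl : IsClosed S)
    {a w : E2} (h : ∀ ε > 0, ∀ᶠ t in 𝓝[>] (0 : ℝ), infDist (a + t • w) S ≤ ε * t) :
    w ∈ derivableCone S a := by
  choose s hs hd using fun t : ℝ => hcl.exists_infDist_eq_dist hne (a + t • w)
  refine ⟨s, hs, ?_⟩
  rw [Metric.tendsto_nhds]
  intro ε hε
  filter_upwards [h (ε / 2) (half_pos hε), self_mem_nhdsWithin] with t ht ht0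
  have ht0 : 0 < t := ht0
  have e : t⁻¹ • (s t - a) - w = t⁻¹ • (s t - (a + t • w)) := by
    rw [← sub_sub, smul_sub _ (s t - a), smul_smul, inv_mul_cancel₀ ht0.ne', one_smul]
  rw [dist_eq_norm, e, norm_smul, ← dist_eq_norm, dist_comm, ← hd, norm_inv,
    Real.norm_of_nonneg ht0.le, inv_mul_lt_iff₀ ht0]
  nlinarith

theorem ProximalIneq.mem_derivableCone_of_tendsto {S : Set E2} {ρ : ℝ} (hρ : 0 < ρ)
    (hcl : IsClosed S) (hS : ProximalIneq S ρ) {a w : E2} (ha : a ∈ S) {t : ℕ → ℝ}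
    {b : ℕ → E2} (ht : ∀ n, 0 < t n) (ht0 : Tendsto t atTop (𝓝 0)) (hb : ∀ n, b n ∈ S)
    (hlim : Tendsto (fun n => (t n)⁻¹ • (b n - a)) atTop (𝓝 w)) : w ∈ derivableCone S a := by
  refine mem_derivableCone_of_infDist_le ⟨a, ha⟩ hcl fun ε hε => ?_
  set u : ℕ → E2 := fun n => (t n)⁻¹ • (b n - a) with hu
  have hbu : ∀ n, b n - a = t n • u n := fun n => by
    rw [hu, smul_smul, mul_inv_cancel₀ (ht n).ne', one_smul]
  have h1 : Tendsto (fun n => t n * ‖u n‖ ^ 2 / ρ + ‖u n - w‖) atTop (𝓝 0) := by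
    have := ((ht0.mul (hlim.norm.pow 2)).div_const ρ).add (hlim.sub_const w).norm
    simpa using this
  have h2 : Tendsto (fun n => ‖b n - a‖) atTop (𝓝 0) := by
    have := (ht0.smul hlim).norm
    rw [zero_smul, norm_zero] at this
    exact this.congr fun n => by rw [← hbu]
  obtain ⟨n, hn1, hn2⟩ := ((h1.eventually (gt_mem_nhds hε)).and
    (h2.eventually (gt_mem_nhds hρ))).exists
  filter_upwards [Ioo_mem_nhdsGT (ht n)] with τ hτ
  have h3 := hS.infDist_segment_le hcl ha (hb n) hn2 (l := τ / t n)
    ⟨div_nonneg hτ.1.le (ht n).le, (div_le_one (ht n)).2 hτ.2.le⟩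
  have e1 : (τ / t n) • (b n - a) = τ • u n := by
    rw [hbu, smul_smul, div_mul_cancel₀ _ (ht n).ne']
  have e2 : τ / t n * (‖b n - a‖ ^ 2 / ρ) = τ * (t n * ‖u n‖ ^ 2 / ρ) := by
    rw [hbu, norm_smul, Real.norm_of_nonneg (ht n).le]
    have := (ht n).ne'
    field_simp
  rw [e1, e2] at h3
  have h4 := infDist_le_infDist_add_dist (s := S) (x := a + τ • w) (y := a + τ • u n)
  rw [dist_add_left, dist_comm, dist_eq_norm, ← smul_sub, norm_smul,
    Real.norm_of_nonneg hτ.1.le] at h4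
  nlinarith [hτ.1]

theorem ProximalIneq.midpoint_mem_derivableCone {S : Set E2} {ρ : ℝ} (hρ : 0 < ρ)
    (hcl : IsClosed S) (hS : ProximalIneq S ρ) {a w₁ w₂ : E2} (ha : a ∈ S)
    (h₁ : w₁ ∈ derivableCone S a) (h₂ : w₂ ∈ derivableCone S a) :
    (2 : ℝ)⁻¹ • (w₁ + w₂) ∈ derivableCone S a := by
  obtain ⟨s₁, hs₁, hl₁⟩ := h₁
  obtain ⟨s₂, hs₂, hl₂⟩ := h₂
  set w := (2 : ℝ)⁻¹ • (w₁ + w₂) with hw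
  refine mem_derivableCone_of_infDist_le ⟨a, ha⟩ hcl fun ε hε => ?_
  set u₁ : ℝ → E2 := fun t => t⁻¹ • (s₁ t - a) with hu₁
  set u₂ : ℝ → E2 := fun t => t⁻¹ • (s₂ t - a) with hu₂
  have hid : Tendsto (fun t : ℝ => t) (𝓝[>] 0) (𝓝 0) := tendsto_id.mono_left nhdsWithin_le_nhds
  have hA : Tendsto (fun t => t * ‖u₂ t - u₁ t‖) (𝓝[>] 0) (𝓝 0) := by
    simpa using hid.mul (hl₂.sub hl₁).norm
  have hB : Tendsto (fun t => 2⁻¹ * (t * ‖u₂ t - u₁ t‖ ^ 2 / ρ) +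
      ‖(2 : ℝ)⁻¹ • (u₁ t + u₂ t) - w‖) (𝓝[>] 0) (𝓝 0) := by
    have := (((hid.mul ((hl₂.sub hl₁).norm.pow 2)).div_const ρ).const_mul (2⁻¹ : ℝ)).add
      (((hl₁.add hl₂).const_smul (2⁻¹ : ℝ)).sub_const w).norm
    simpa [hw] using this
  filter_upwards [self_mem_nhdsWithin, hA.eventually (gt_mem_nhds hρ),
    hB.eventually (gt_mem_nhds hε)] with t ht hAt hBt
  have ht : 0 < t := ht
  have e₁ : s₁ t = a + t • u₁ t := by
    rw [hu₁, smul_smul, mul_inv_cancel₀ ht.ne', one_smul]; abel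
  have e₂ : s₂ t = a + t • u₂ t := by
    rw [hu₂, smul_smul, mul_inv_cancel₀ ht.ne', one_smul]; abel
  have e₃ : s₂ t - s₁ t = t • (u₂ t - u₁ t) := by rw [e₁, e₂]; module
  have e₄ : ‖s₂ t - s₁ t‖ = t * ‖u₂ t - u₁ t‖ := by
    rw [e₃, norm_smul, Real.norm_of_nonneg ht.le]
  have h3 := hS.infDist_segment_le hcl (hs₁ t) (hs₂ t) (by rwa [e₄]) (l := 2⁻¹)
    ⟨by norm_num, by norm_num⟩
  have e₅ : s₁ t + (2 : ℝ)⁻¹ • (s₂ t - s₁ t) = a + t • ((2 : ℝ)⁻¹ • (u₁ t + u₂ t)) := by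
    rw [e₃, e₁]; module
  rw [e₅, e₄] at h3
  have h4 := infDist_le_infDist_add_dist (s := S) (x := a + t • w)
    (y := a + t • ((2 : ℝ)⁻¹ • (u₁ t + u₂ t)))
  rw [dist_add_left, dist_comm, dist_eq_norm, ← smul_sub, norm_smul,
    Real.norm_of_nonneg ht.le] at h4
  have h5 : (2 : ℝ)⁻¹ * ((t * ‖u₂ t - u₁ t‖) ^ 2 / ρ) =
      t * (2⁻¹ * (t * ‖u₂ t - u₁ t‖ ^ 2 / ρ)) := by ring
  rw [h5] at h3
  nlinarith

theorem ProximalIneq.add_mem_derivableCone {S : Set E2} {ρ : ℝ} (hρ : 0 < ρ)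
    (hcl : IsClosed S) (hS : ProximalIneq S ρ) {a w₁ w₂ : E2} (ha : a ∈ S)
    (h₁ : w₁ ∈ derivableCone S a) (h₂ : w₂ ∈ derivableCone S a) :
    w₁ + w₂ ∈ derivableCone S a := by
  have := smul_mem_derivableCone (hS.midpoint_mem_derivableCone hρ hcl ha h₁ h₂) two_pos
  rwa [smul_smul, mul_inv_cancel₀ two_ne_zero, one_smul] at this

theorem ProximalIneq.exists_mem_derivableCone {S : Set E2} {ρ : ℝ} (hρ : 0 < ρ)
    (hcl : IsClosed S) (hS : ProximalIneq S ρ) {a b : E2} (ha : a ∈ S) (hb : b ∈ S)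
    (hab : ‖b - a‖ < ρ) :
    ∃ w ∈ derivableCone S a, ‖w - (b - a)‖ ≤ ‖b - a‖ ^ 2 / ρ := by
  set t : ℕ → ℝ := fun n => 1 / ((n : ℝ) + 1) with htdef
  have ht : ∀ n, 0 < t n := fun n => by positivity
  have ht1 : ∀ n, t n ≤ 1 := fun n => by
    rw [htdef]; exact (div_le_one (by positivity)).2 (by linarith [n.cast_nonneg (α := ℝ)])
  choose s hs hd using fun n => hcl.exists_infDist_eq_dist ⟨a, ha⟩ (a + t n • (b - a))
  have hmem : ∀ n, (t n)⁻¹ • (s n - a) ∈ closedBall (b - a) (‖b - a‖ ^ 2 / ρ) := fun n => by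
    have h := hS.infDist_segment_le hcl ha hb hab ⟨(ht n).le, ht1 n⟩
    have e : (t n)⁻¹ • (s n - a) - (b - a) = (t n)⁻¹ • (s n - (a + t n • (b - a))) := by
      rw [← sub_sub, smul_sub _ (s n - a), smul_smul, inv_mul_cancel₀ (ht n).ne', one_smul]
    rw [hd, dist_comm, dist_eq_norm] at h
    rw [mem_closedBall, dist_eq_norm, e, norm_smul, norm_inv, Real.norm_of_nonneg (ht n).le,
      inv_mul_le_iff₀ (ht n)]
    exact h
  obtain ⟨w, hw, φ, hφ, hlim⟩ := (isCompact_closedBall _ _).tendsto_subseq hmem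
  refine ⟨w, ?_, by simpa [dist_eq_norm] using hw⟩
  exact hS.mem_derivableCone_of_tendsto hρ hcl ha (t := t ∘ φ) (b := s ∘ φ) (fun n => ht _)
    (tendsto_one_div_add_atTop_nhds_zero_nat.comp hφ.tendsto_atTop) (fun n => hs _) hlim

theorem ProximalIneq.det_eq_zero_of_mem_derivableCone {S : Set E2} {ρ : ℝ} (hρ : 0 < ρ)
    (hcl : IsClosed S) (hS : ProximalIneq S ρ) (hint : interior S = ∅) {a w₁ w₂ : E2}
    (ha : a ∈ S) (h₁ : w₁ ∈ derivableCone S a) (h₂ : w₂ ∈ derivableCone S a) :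
    w₁ 0 * w₂ 1 - w₁ 1 * w₂ 0 = 0 := by
  obtain ⟨s, hs, hl⟩ := hS.add_mem_derivableCone hρ hcl ha h₁ h₂
  obtain ⟨s₁, hs₁, hl₁⟩ := smul_mem_derivableCone h₁ four_pos
  obtain ⟨s₂, hs₂, hl₂⟩ := smul_mem_derivableCone h₂ four_pos
  set t : ℕ → ℝ := fun n => 1 / ((n : ℝ) + 1) with htdef
  have ht : ∀ n, 0 < t n := fun n => by positivity
  have ht0 : Tendsto t atTop (𝓝 0) := tendsto_one_div_add_atTop_nhds_zero_nat
  have ht' : Tendsto t atTop (𝓝[>] 0) :=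
    tendsto_nhdsWithin_iff.2 ⟨ht0, Eventually.of_forall ht⟩
  choose v hv hvq using fun n => hS.exists_normal hρ hcl hint (hs (t n))
  obtain ⟨ν, hν, φ, hφ, hlim⟩ := (isCompact_sphere (0 : E2) 1).tendsto_subseq (x := v)
    (fun n => by simp [hv n])
  have hφ' := hφ.tendsto_atTop
  have key : ∀ (σ : ℝ → E2) (z : E2), (∀ t, σ t ∈ S) →
      Tendsto (fun t => t⁻¹ • (σ t - a)) (𝓝[>] 0) (𝓝 z) →
      inner ℝ ν (z - (w₁ + w₂)) ≤ 0 := by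
    intro σ z hσ hz
    have hdiff : Tendsto (fun n => (t (φ n))⁻¹ • (σ (t (φ n)) - s (t (φ n)))) atTop
        (𝓝 (z - (w₁ + w₂))) := by
      refine ((hz.sub hl).comp (ht'.comp hφ')).congr fun n => ?_
      simp only [Function.comp, ← smul_sub, sub_sub_sub_cancel_right]
    have hL := (hlim.inner hdiff).const_mul (2 * ρ)
    have hR := (ht0.comp hφ').mul (hdiff.norm.pow 2)
    have hle : 2 * ρ * inner ℝ ν (z - (w₁ + w₂)) ≤ 0 * ‖z - (w₁ + w₂)‖ ^ 2 := by
      refine le_of_tendsto_of_tendsto' hL hR fun n => ?_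
      have h := hvq (φ n) _ (hσ (t (φ n)))
      have hp := ht (φ n)
      simp only [Function.comp]
      rw [real_inner_smul_right, norm_smul, norm_inv, Real.norm_of_nonneg hp.le]
      set T := t (φ n)
      have e1 : T * (T⁻¹ * ‖σ T - s T‖) ^ 2 = T⁻¹ * ‖σ T - s T‖ ^ 2 := by
        field_simp
      rw [e1, mul_left_comm]
      exact mul_le_mul_of_nonneg_left h (inv_nonneg.2 hp.le)
    nlinarith
  have k0 := key (fun _ => a) 0 (fun _ => ha) (by simp)
  have k1 := key s₁ _ hs₁ hl₁
  have k2 := key s₂ _ hs₂ hl₂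
  simp only [inner_sub_right, inner_add_right, inner_zero_right, real_inner_smul_right] at k0 k1 k2
  have hA : inner ℝ ν w₁ = 0 := by linarith
  have hB : inner ℝ ν w₂ = 0 := by linarith
  simp only [PiLp.inner_apply, Fin.sum_univ_two, RCLike.inner_apply, conj_trivial] at hA hB
  have hn : ν 0 ^ 2 + ν 1 ^ 2 = 1 := by
    have : ‖ν‖ = 1 := by simpa using hν
    have h := EuclideanSpace.norm_sq_eq ν
    simpa [this, Fin.sum_univ_two, eq_comm] using h
  have e0 : ν 0 * (w₁ 0 * w₂ 1 - w₁ 1 * w₂ 0) = 0 := by linear_combination w₂ 1 * hA - w₁ 1 * hB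
  have e1 : ν 1 * (w₁ 0 * w₂ 1 - w₁ 1 * w₂ 0) = 0 := by linear_combination w₁ 0 * hB - w₂ 0 * hA
  linear_combination ν 0 * e0 + ν 1 * e1 - (w₁ 0 * w₂ 1 - w₁ 1 * w₂ 0) * hn

/-- `S` lies, near `a`, between two parabolas tangent to the line through `a` with unit
normal `n`. -/
theorem ProximalIneq.exists_tangent_line {S : Set E2} {ρ : ℝ} (hρ : 0 < ρ)
    (hcl : IsClosed S) (hS : ProximalIneq S ρ) (hint : interior S = ∅) {a : E2} (ha : a ∈ S)
    (hacc : ∀ η > 0, ∃ b ∈ S, b ≠ a ∧ dist b a < η) :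
    ∃ n : E2, ‖n‖ = 1 ∧ ∀ b ∈ S, ‖b - a‖ < ρ → |inner ℝ n (b - a)| ≤ ‖b - a‖ ^ 2 / ρ := by
  obtain ⟨b₀, hb₀, hne, hlt⟩ := hacc ρ hρ
  rw [dist_eq_norm] at hlt
  obtain ⟨w, hw, hwb⟩ := hS.exists_mem_derivableCone hρ hcl ha hb₀ hlt
  have hpos : 0 < ‖b₀ - a‖ := norm_pos_iff.2 (sub_ne_zero.2 hne)
  have hw0 : w ≠ 0 := by
    rintro rfl
    rw [zero_sub, norm_neg, le_div_iff₀ hρ] at hwb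
    nlinarith
  set J : E2 := !₂[-w 1, w 0] with hJ
  have hJin : ∀ z : E2, inner ℝ J z = w 0 * z 1 - w 1 * z 0 := fun z => by
    simp [PiLp.inner_apply, Fin.sum_univ_two, hJ]; ring
  have hJ0 : J ≠ 0 := by
    intro h
    apply hw0
    have h0 := congrArg (fun z : E2 => z 0) h
    have h1 := congrArg (fun z : E2 => z 1) h
    simp [hJ] at h0 h1
    ext i; fin_cases i <;> simp [h0, h1]
  have hn1 : ‖(‖J‖⁻¹ : ℝ) • J‖ = 1 := by
    rw [norm_smul, norm_inv, norm_norm, inv_mul_cancel₀ (norm_ne_zero_iff.2 hJ0)]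
  refine ⟨(‖J‖⁻¹ : ℝ) • J, hn1, fun b hb hba => ?_⟩
  obtain ⟨z, hz, hzb⟩ := hS.exists_mem_derivableCone hρ hcl ha hb hba
  have hdet := hS.det_eq_zero_of_mem_derivableCone hρ hcl hint ha hw hz
  have e : inner ℝ ((‖J‖⁻¹ : ℝ) • J) (b - a) = - inner ℝ ((‖J‖⁻¹ : ℝ) • J) (z - (b - a)) := by
    have hz0 : inner ℝ ((‖J‖⁻¹ : ℝ) • J) z = 0 := by
      rw [real_inner_smul_left, hJin, hdet, mul_zero]
    rw [inner_sub_right _ z, hz0, zero_sub, neg_neg]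
  rw [e, abs_neg]
  refine (abs_real_inner_le_norm _ _).trans ?_
  rwa [hn1, one_mul]

theorem exists_contDiff_extension {A : Set ℝ} (hA : Convex ℝ A) (hA0 : (0 : ℝ) ∈ A)
    {Y M : ℝ → ℝ} {C : ℝ}
    (hC : 0 ≤ C) (h : ∀ s ∈ A, ∀ t ∈ A, |Y s - Y t - M t * (s - t)| ≤ C * (s - t) ^ 2) :
    ∃ g : ℝ → ℝ, ContDiff ℝ 1 g ∧ (∃ K : NNReal, LipschitzWith K (deriv g)) ∧
      ∀ t ∈ A, g t = Y t := by
  have hlip : LipschitzOnWith (2 * C).toNNReal M A := by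
    refine LipschitzOnWith.of_dist_le_mul fun s hs t ht => ?_
    rw [Real.coe_toNNReal _ (by linarith), Real.dist_eq, Real.dist_eq]
    rcases eq_or_ne s t with rfl | hst
    · simp
    have hpos : 0 < |s - t| := abs_pos.2 (sub_ne_zero.2 hst)
    refine le_of_mul_le_mul_right ?_ hpos
    rw [← abs_mul, mul_assoc, ← sq, sq_abs]
    have h1 := abs_le.1 (h s hs t ht)
    have h2 := abs_le.1 (h t ht s hs)
    rw [abs_le]
    constructor <;> nlinarith
  obtain ⟨m, hm, hmM⟩ := hlip.extend_real
  set g : ℝ → ℝ := fun t => Y 0 + ∫ x in (0 : ℝ)..t, m x with hg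
  have hder : ∀ t, HasDerivAt g (m t) t := fun t =>
    (intervalIntegral.integral_hasDerivAt_right (hm.continuous.intervalIntegrable _ _)
      (hm.continuous.stronglyMeasurableAtFilter _ _) hm.continuous.continuousAt).const_add _
  have hderiv : deriv g = m := funext fun t => (hder t).deriv
  refine ⟨g, contDiff_one_iff_deriv.2 ⟨fun t => (hder t).differentiableAt, ?_⟩, ⟨(2 * C).toNNReal, ?_⟩, ?_⟩
  · rw [hderiv]; exact hm.continuous
  · rw [hderiv]; exact hm
  intro t ht
  have hY : ∀ x ∈ A, HasDerivWithinAt (fun x => Y x - g x) 0 A x := by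
    intro x hx
    have h1 : HasDerivWithinAt Y (m x) A x := by
      rw [hasDerivWithinAt_iff_isLittleO, ← hmM hx]
      have hO : (fun s => Y s - Y x - (s - x) • M x) =O[𝓝[A] x] fun s => (s - x) ^ 2 := by
        refine Asymptotics.IsBigO.of_bound C ?_
        filter_upwards [self_mem_nhdsWithin] with s hs
        rw [Real.norm_eq_abs, Real.norm_of_nonneg (sq_nonneg _), smul_eq_mul, mul_comm (s - x)]
        exact h s hs x hx
      refine hO.trans_isLittleO ?_
      have : (fun s : ℝ => (s - x) ^ 2) =o[𝓝 x] fun s => s - x := by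
        simpa using Asymptotics.isLittleO_pow_sub_sub x one_lt_two
      exact this.mono nhdsWithin_le_nhds
    have := h1.sub (hder x).hasDerivWithinAt
    rwa [sub_self] at this
  have hc := hA.norm_image_sub_le_of_norm_hasDerivWithin_le (C := 0) hY (fun _ _ => by simp) hA0 ht
  have hg0 : g 0 = Y 0 := by simp [hg]
  rw [zero_mul, norm_le_zero_iff, hg0, sub_self, sub_zero, sub_eq_zero] at hc
  exact hc.symm

theorem convex_of_exists_between {A : Set ℝ} (hA : IsCompact A)
    (h : ∀ s ∈ A, ∀ t ∈ A, s < t → ∃ u ∈ A, s < u ∧ u < t) : Convex ℝ A := by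
  refine Set.OrdConnected.convex ⟨fun s hs t ht u hu => ?_⟩
  by_contra hnu
  obtain ⟨l, hl, hlmax⟩ := (hA.inter_right isClosed_Iic).exists_isGreatest ⟨s, hs, hu.1⟩
  obtain ⟨r, hr, hrmin⟩ := (hA.inter_right isClosed_Ici).exists_isLeast ⟨t, ht, hu.2⟩
  have hlu : l < u := lt_of_le_of_ne hl.2 fun e => hnu (e ▸ hl.1)
  have hur : u < r := lt_of_le_of_ne hr.2 fun e => hnu (e ▸ hr.1)
  obtain ⟨v, hv, hlv, hvr⟩ := h l hl.1 r hr.1 (hlu.trans hur)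
  rcases le_total v u with hvu | hvu
  · exact absurd (hlmax ⟨hv, hvu⟩) (not_le.2 hlv)
  · exact absurd (hrmin ⟨hv, hvu⟩) (not_le.2 hvr)

theorem exists_slope {S : Set (ℝ × ℝ)} {ρ δ : ℝ} (hδ : 0 < δ) (hρδ : ρ = 1000 * δ)
    (hN : ∀ a ∈ S, ∃ n₁ n₂ : ℝ, n₁ ^ 2 + n₂ ^ 2 = 1 ∧ ∀ b ∈ S,
      (b.1 - a.1) ^ 2 + (b.2 - a.2) ^ 2 < ρ ^ 2 →
      ρ * |n₁ * (b.1 - a.1) + n₂ * (b.2 - a.2)| ≤ (b.1 - a.1) ^ 2 + (b.2 - a.2) ^ 2)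
    (h0S : (0 : ℝ × ℝ) ∈ S)
    (h0 : ∀ b ∈ S, b.1 ^ 2 + b.2 ^ 2 < ρ ^ 2 → ρ * |b.2| ≤ b.1 ^ 2 + b.2 ^ 2)
    {a : ℝ × ℝ} (ha : a ∈ S) (ha1 : |a.1| ≤ δ) (ha2 : |a.2| ≤ 5 * δ) :
    ∃ m : ℝ, ∀ b ∈ S, |b.1| ≤ δ → |b.2| ≤ 5 * δ →
      |b.2 - a.2| ≤ |b.1 - a.1| ∧
      ρ * |b.2 - a.2 - m * (b.1 - a.1)| ≤ 4 * (b.1 - a.1) ^ 2 := by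
  have hsq : ∀ x y : ℝ, x ^ 2 + y ^ 2 = |x| * |x| + |y| * |y| := fun x y => by
    rw [abs_mul_abs_self, abs_mul_abs_self]; ring
  have hsmall : ∀ x y : ℝ, |x| ≤ 2 * δ → |y| ≤ 10 * δ → x ^ 2 + y ^ 2 < ρ ^ 2 := by
    intro x y hx hy
    have := abs_nonneg x
    have := abs_nonneg y
    rw [hsq, hρδ]; nlinarith
  have haa : 200 * |a.2| ≤ |a.1| := by
    have h := h0 a ha (hsmall _ _ (by linarith) (by linarith))
    have := abs_nonneg a.1
    have := abs_nonneg a.2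
    rw [hsq, hρδ] at h
    have : |a.1| * |a.1| ≤ δ * |a.1| := mul_le_mul_of_nonneg_right ha1 (abs_nonneg _)
    have : |a.2| * |a.2| ≤ 5 * δ * |a.2| := mul_le_mul_of_nonneg_right ha2 (abs_nonneg _)
    have : δ * (995 * |a.2|) ≤ δ * |a.1| := by linarith
    have := le_of_mul_le_mul_left this hδ
    linarith
  obtain ⟨n₁, n₂, hn, hn₁, hb⟩ : ∃ n₁ n₂ : ℝ, n₁ ^ 2 + n₂ ^ 2 = 1 ∧ |n₁| ≤ 1 / 50 ∧ ∀ b ∈ S,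
      (b.1 - a.1) ^ 2 + (b.2 - a.2) ^ 2 < ρ ^ 2 →
      ρ * |n₁ * (b.1 - a.1) + n₂ * (b.2 - a.2)| ≤ (b.1 - a.1) ^ 2 + (b.2 - a.2) ^ 2 := by
    rcases eq_or_ne a.1 0 with h1 | h1
    · have h2 : a.2 = 0 := by
        rw [h1, abs_zero] at haa
        exact abs_eq_zero.1 (le_antisymm (by linarith) (abs_nonneg _))
      refine ⟨0, 1, by norm_num, by norm_num, fun b hb hlt => ?_⟩
      rw [h1, h2] at hlt ⊢
      simp only [sub_zero, zero_mul, zero_add, one_mul] at hlt ⊢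
      exact h0 b hb hlt
    · obtain ⟨n₁, n₂, hn, hb⟩ := hN a ha
      refine ⟨n₁, n₂, hn, ?_, hb⟩
      have hpos : 0 < |a.1| := abs_pos.2 h1
      have h := hb 0 h0S (hsmall _ _ (by simp; linarith) (by simp; linarith))
      simp only [Prod.fst_zero, Prod.snd_zero, zero_sub, neg_sq] at h
      have hn₂ : |n₂| ≤ 1 := abs_le_one_iff_mul_self_le_one.2 (by nlinarith [sq_nonneg n₁])
      have e1 : |n₁| * |a.1| ≤ |n₁ * -a.1 + n₂ * -a.2| + |n₂| * |a.2| := by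
        rw [← abs_mul, ← abs_mul]
        have : n₁ * a.1 = -(n₁ * -a.1 + n₂ * -a.2) + -(n₂ * a.2) := by ring
        rw [this]
        refine (abs_add_le _ _).trans ?_
        rw [abs_neg, abs_neg]
      rw [hsq, hρδ] at h
      have : |a.1| * |a.1| ≤ δ * |a.1| := mul_le_mul_of_nonneg_right ha1 (abs_nonneg _)
      have : |a.2| * |a.2| ≤ 5 * δ * |a.2| := mul_le_mul_of_nonneg_right ha2 (abs_nonneg _)
      have h3 : δ * (1000 * |n₁ * -a.1 + n₂ * -a.2|) ≤ δ * (|a.1| + 5 * |a.2|) := by linarith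
      have h4 := le_of_mul_le_mul_left h3 hδ
      have h5 : |n₂| * |a.2| ≤ 1 * |a.2| := mul_le_mul_of_nonneg_right hn₂ (abs_nonneg _)
      refine le_of_mul_le_mul_right ?_ hpos
      linarith
  have hn₂ : 9 / 10 ≤ |n₂| := by
    have h1 : n₁ ^ 2 ≤ (1 / 50) ^ 2 := sq_le_sq' (abs_le.1 hn₁).1 (abs_le.1 hn₁).2
    refine le_of_sq_le_sq ?_ (abs_nonneg _)
    rw [sq_abs]; nlinarith
  have hn₂0 : n₂ ≠ 0 := by
    rintro rfl
    norm_num at hn₂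
  refine ⟨-(n₁ / n₂), fun b hbS hb1 hb2 => ?_⟩
  have hx := (abs_sub b.1 a.1).trans (add_le_add hb1 ha1)
  have hy := (abs_sub b.2 a.2).trans (add_le_add hb2 ha2)
  have h := hb b hbS (hsmall _ _ (by linarith) (by linarith))
  set x := b.1 - a.1
  set y := b.2 - a.2
  have e : y - -(n₁ / n₂) * x = (n₁ * x + n₂ * y) / n₂ := by field_simp; ring
  have h2 : ρ * |y - -(n₁ / n₂) * x| ≤ 2 * (x ^ 2 + y ^ 2) := by
    rw [e, abs_div, mul_div_assoc', div_le_iff₀ (by linarith)]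
    nlinarith [sq_nonneg x, sq_nonneg y]
  have hyx : |y| ≤ |x| := by
    have e1 : |n₂| * |y| ≤ |n₁ * x + n₂ * y| + |n₁| * |x| := by
      rw [← abs_mul, ← abs_mul]
      have : n₂ * y = (n₁ * x + n₂ * y) + -(n₁ * x) := by ring
      rw [this]
      refine (abs_add_le _ _).trans ?_
      rw [abs_neg, ← this]
    rw [hsq, hρδ] at h
    have : |x| * |x| ≤ 2 * δ * |x| := mul_le_mul_of_nonneg_right (by linarith) (abs_nonneg _)
    have : |y| * |y| ≤ 10 * δ * |y| := mul_le_mul_of_nonneg_right (by linarith) (abs_nonneg _)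
    have h3 : δ * (1000 * |n₁ * x + n₂ * y|) ≤ δ * (2 * |x| + 10 * |y|) := by linarith
    have h4 := le_of_mul_le_mul_left h3 hδ
    have h5 : |n₁| * |x| ≤ 1 / 50 * |x| := mul_le_mul_of_nonneg_right hn₁ (abs_nonneg _)
    have h6 : 9 / 10 * |y| ≤ |n₂| * |y| := mul_le_mul_of_nonneg_right hn₂ (abs_nonneg _)
    linarith [abs_nonneg x]
  refine ⟨hyx, h2.trans ?_⟩
  have := sq_le_sq.2 hyx
  linarith

theorem exists_graph_of_flat {S : Set (ℝ × ℝ)} {ρ : ℝ} (hρ : 0 < ρ) (hcl : IsClosed S)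
    (hN : ∀ a ∈ S, ∃ n₁ n₂ : ℝ, n₁ ^ 2 + n₂ ^ 2 = 1 ∧ ∀ b ∈ S,
      (b.1 - a.1) ^ 2 + (b.2 - a.2) ^ 2 < ρ ^ 2 →
      ρ * |n₁ * (b.1 - a.1) + n₂ * (b.2 - a.2)| ≤ (b.1 - a.1) ^ 2 + (b.2 - a.2) ^ 2)
    (hG : ∀ a ∈ S, ∀ b ∈ S, (b.1 - a.1) ^ 2 + (b.2 - a.2) ^ 2 < ρ ^ 2 → ∃ q ∈ S,
      2 * ρ * |q.1 - (a.1 + b.1) / 2| ≤ (b.1 - a.1) ^ 2 + (b.2 - a.2) ^ 2 ∧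
      2 * ρ * |q.2 - (a.2 + b.2) / 2| ≤ (b.1 - a.1) ^ 2 + (b.2 - a.2) ^ 2)
    (h0S : (0 : ℝ × ℝ) ∈ S)
    (h0 : ∀ b ∈ S, b.1 ^ 2 + b.2 ^ 2 < ρ ^ 2 → ρ * |b.2| ≤ b.1 ^ 2 + b.2 ^ 2)
    (hpos : ∀ η > 0, ∃ b ∈ S, 0 < b.1 ∧ b.1 < η ∧ |b.2| < η) :
    ∃ (U : Set (ℝ × ℝ)) (g : ℝ → ℝ) (I : Set ℝ), IsOpen U ∧ (0 : ℝ × ℝ) ∈ U ∧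
      ((∃ a b : ℝ, a < b ∧ I = Set.Ioo a b) ∨ (∃ a b : ℝ, a < b ∧ I = Set.Ico a b)) ∧
      ContDiff ℝ 1 g ∧ (∃ K : NNReal, LipschitzWith K (deriv g)) ∧
      ∀ q : ℝ × ℝ, q ∈ S ∩ U ↔ q.1 ∈ I ∧ q.2 = g q.1 := by
  obtain ⟨δ, hρδ⟩ : ∃ δ, ρ = 1000 * δ := ⟨ρ / 1000, by ring⟩
  have hδ : 0 < δ := by linarith
  set Q : Set (ℝ × ℝ) := Icc (-δ) δ ×ˢ Icc (-(5 * δ)) (5 * δ) with hQ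
  have hmemQ : ∀ q : ℝ × ℝ, q ∈ Q ↔ |q.1| ≤ δ ∧ |q.2| ≤ 5 * δ := fun q => by
    rw [hQ, mem_prod, mem_Icc, mem_Icc, abs_le, abs_le]
  set A : Set ℝ := Prod.fst '' (S ∩ Q) with hA
  have hslope : ∀ a ∈ S ∩ Q, ∃ m : ℝ, ∀ b ∈ S ∩ Q, |b.2 - a.2| ≤ |b.1 - a.1| ∧
      ρ * |b.2 - a.2 - m * (b.1 - a.1)| ≤ 4 * (b.1 - a.1) ^ 2 := fun a ha => by
    have haQ := (hmemQ a).1 ha.2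
    obtain ⟨m, hm⟩ := exists_slope hδ hρδ hN h0S h0 ha.1 haQ.1 haQ.2
    exact ⟨m, fun b hb => hm b hb.1 ((hmemQ b).1 hb.2).1 ((hmemQ b).1 hb.2).2⟩
  have h0Q : (0 : ℝ × ℝ) ∈ S ∩ Q := ⟨h0S, by rw [hmemQ]; simp [hδ.le]⟩
  have hflat : ∀ b ∈ S ∩ Q, |b.2| ≤ |b.1| := fun b hb => by
    obtain ⟨m, hm⟩ := hslope 0 h0Q
    simpa using (hm b hb).1
  have hAc : IsCompact A :=
    ((isCompact_Icc.prod isCompact_Icc).inter_left hcl).image continuous_fst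
  have hA0 : (0 : ℝ) ∈ A := ⟨0, h0Q, rfl⟩
  have hAδ : A ⊆ Icc (-δ) δ := by
    rintro _ ⟨q, hq, rfl⟩
    exact hq.2.1
  have hAconv : Convex ℝ A := by
    refine convex_of_exists_between hAc ?_
    rintro _ ⟨a, ha, rfl⟩ _ ⟨b, hb, rfl⟩ hab
    obtain ⟨m, hm⟩ := hslope a ha
    have hyx := sq_le_sq.2 (hm b hb).1
    have haf := hflat a ha
    have hbf := hflat b hb
    have ha1 := ((hmemQ a).1 ha.2).1
    have hb1 := ((hmemQ b).1 hb.2).1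
    have hx : b.1 - a.1 ≤ 2 * δ := by linarith [(abs_le.1 ha1).1, (abs_le.1 hb1).2]
    have hx0 : 0 < b.1 - a.1 := sub_pos.2 hab
    have hxx : (b.1 - a.1) ^ 2 ≤ 2 * δ * (b.1 - a.1) := by nlinarith
    obtain ⟨q, hq, hq1, hq2⟩ := hG a ha.1 b hb.1 (by rw [hρδ]; nlinarith)
    rw [hρδ] at hq1 hq2
    have hq1' : |q.1 - (a.1 + b.1) / 2| ≤ (b.1 - a.1) / 4 := by
      refine le_of_mul_le_mul_left ?_ hδ
      nlinarith
    have hq2' : |q.2 - (a.2 + b.2) / 2| ≤ (b.1 - a.1) / 4 := by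
      refine le_of_mul_le_mul_left ?_ hδ
      nlinarith
    rw [abs_le] at hq1' hq2' ha1 hb1
    have hay := abs_le.1 (haf.trans (abs_le.2 ha1))
    have hby := abs_le.1 (hbf.trans (abs_le.2 hb1))
    refine ⟨q.1, ⟨q, ⟨hq, ?_⟩, rfl⟩, by linarith, by linarith⟩
    rw [hmemQ, abs_le, abs_le]
    refine ⟨⟨?_, ?_⟩, ?_, ?_⟩ <;> linarith [ha1.1, ha1.2, hb1.1, hb1.2, hay.1, hay.2, hby.1, hby.2]
  have hex : ∀ t ∈ A, ∃ y : ℝ, (t, y) ∈ S ∩ Q := by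
    rintro _ ⟨q, hq, rfl⟩
    exact ⟨q.2, hq⟩
  choose! Y hY using hex
  have hex2 : ∀ t ∈ A, ∃ m : ℝ, ∀ b ∈ S ∩ Q, |b.2 - Y t| ≤ |b.1 - t| ∧
      ρ * |b.2 - Y t - m * (b.1 - t)| ≤ 4 * (b.1 - t) ^ 2 := fun t ht => hslope _ (hY t ht)
  choose! M hM using hex2
  have hYq : ∀ q ∈ S ∩ Q, q.2 = Y q.1 := fun q hq => by
    have := (hM q.1 ⟨q, hq, rfl⟩ q hq).1
    rw [sub_self, abs_zero] at this
    exact sub_eq_zero.1 (abs_nonpos_iff.1 this)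
  obtain ⟨g, hg1, hg2, hgY⟩ := exists_contDiff_extension (M := M) (Y := Y) (C := 4 / ρ) hAconv hA0
    (by positivity) (fun s hs t ht => by
      have := (hM t ht _ (hY s hs)).2
      rw [div_mul_eq_mul_div, le_div_iff₀ hρ, mul_comm]
      exact this)
  have finish : ∀ J I : Set ℝ, J ⊆ Icc (-δ) δ →
      (∀ t, t ∈ I ↔ t ∈ J ∧ t ∈ A) → ∀ q : ℝ × ℝ,
      q ∈ S ∩ (J ×ˢ Ioo (-(5 * δ)) (5 * δ)) ↔ q.1 ∈ I ∧ q.2 = g q.1 := by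
    intro J I hJδ hI q
    constructor
    · rintro ⟨hqS, hqJ, hq2⟩
      have hqQ : q ∈ S ∩ Q := ⟨hqS, hJδ hqJ, Ioo_subset_Icc_self hq2⟩
      have hqA : q.1 ∈ A := ⟨q, hqQ, rfl⟩
      exact ⟨(hI _).2 ⟨hqJ, hqA⟩, by rw [hYq q hqQ, hgY _ hqA]⟩
    · rintro ⟨hqI, hq2⟩
      obtain ⟨hqJ, hqA⟩ := (hI _).1 hqI
      have hqQ : q ∈ S ∩ Q := by
        have := hY _ hqA
        rwa [← hgY _ hqA, ← hq2] at this
      refine ⟨hqQ.1, hqJ, ?_⟩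
      rw [mem_Ioo, ← abs_lt]
      have := (hflat q hqQ).trans ((hmemQ q).1 hqQ.2).1
      linarith
  obtain ⟨β, hβ, hβmax⟩ := hAc.exists_isGreatest ⟨0, hA0⟩
  obtain ⟨α, hα, hαmin⟩ := hAc.exists_isLeast ⟨0, hA0⟩
  have hβ0 : 0 < β := by
    obtain ⟨b, hb, hb0, hb1, hb2⟩ := hpos δ hδ
    refine hb0.trans_le (hβmax ⟨b, ⟨hb, ?_⟩, rfl⟩)
    rw [hmemQ, abs_of_pos hb0]
    exact ⟨hb1.le, by linarith⟩
  have hα0 : α ≤ 0 := hαmin hA0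
  have hord := hAconv.ordConnected
  have h5 : (0 : ℝ) ∈ Ioo (-(5 * δ)) (5 * δ) := by constructor <;> linarith
  rcases hα0.lt_or_eq with hα0 | hα0
  · have hsub : Ioo α β ⊆ A := Ioo_subset_Icc_self.trans (hord.out hα hβ)
    exact ⟨_, g, Ioo α β, isOpen_Ioo.prod isOpen_Ioo, ⟨⟨hα0, hβ0⟩, h5⟩,
      Or.inl ⟨α, β, hα0.trans hβ0, rfl⟩, hg1, hg2, finish (Ioo α β) _
        (hsub.trans hAδ) fun t => ⟨fun ht => ⟨ht, hsub ht⟩, And.left⟩⟩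
  · refine ⟨_, g, Ico 0 β, isOpen_Ioo.prod isOpen_Ioo, ⟨⟨?_, hβ0⟩, h5⟩,
      Or.inr ⟨0, β, hβ0, rfl⟩, hg1, hg2, finish (Ioo (-δ) β) _
        (fun t ht => ⟨ht.1.le, ht.2.le.trans (hAδ hβ).2⟩) fun t => ⟨fun ht => ?_, fun ht => ?_⟩⟩
    · simpa using hδ
    · exact ⟨⟨by linarith [ht.1], ht.2⟩, hord.out hA0 hβ ⟨ht.1, ht.2.le⟩⟩
    · exact ⟨by simpa [hα0] using hαmin ht.2, ht.1.2⟩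

theorem exists_rigid_motion (p : E2) {τ ν : E2} (hτ : ‖τ‖ = 1) (hν : ‖ν‖ = 1)
    (h : inner ℝ τ ν = 0) :
    ∃ e : E2 ≃ᵃⁱ[ℝ] E2, ∀ q, e q 0 = inner ℝ τ (q - p) ∧ e q 1 = inner ℝ ν (q - p) := by
  have ho : Orthonormal ℝ ![τ, ν] := by
    refine ⟨fun i => by fin_cases i <;> simpa, fun i j hij => ?_⟩
    fin_cases i <;> fin_cases j <;> simp_all [real_inner_comm]
  have hcard : Fintype.card (Fin 2) = Module.finrank ℝ E2 := by simp
  set b := (basisOfOrthonormalOfCardEqFinrank ho hcard).toOrthonormalBasis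
    (by rwa [coe_basisOfOrthonormalOfCardEqFinrank]) with hb
  have hbi : ∀ i, b i = ![τ, ν] i := fun i => by simp [hb]
  refine ⟨(AffineIsometryEquiv.vaddConst ℝ p).symm.trans b.repr.toAffineIsometryEquiv, fun q => ?_⟩
  constructor
  · simp [OrthonormalBasis.repr_apply_apply, hbi, inner_sub_right]
  · simp [OrthonormalBasis.repr_apply_apply, hbi, inner_sub_right]

theorem pt_zero (a b : ℝ) : pt a b 0 = a := by simp [pt]

theorem pt_one (a b : ℝ) : pt a b 1 = b := by simp [pt]

theorem pt_eta (z : E2) : pt (z 0) (z 1) = z := by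
  ext i; fin_cases i
  · exact pt_zero _ _
  · exact pt_one _ _

theorem norm_sq_eq_add (z : E2) : ‖z‖ ^ 2 = z 0 ^ 2 + z 1 ^ 2 := by
  simp [EuclideanSpace.norm_sq_eq, Fin.sum_univ_two]

theorem continuous_pt : Continuous fun x : ℝ × ℝ => pt x.1 x.2 := by
  refine (EuclideanSpace.equiv (Fin 2) ℝ).symm.continuous.comp (continuous_pi fun i => ?_)
  fin_cases i
  · exact continuous_fst
  · exact continuous_snd

theorem ProximalIneq.isC11GraphAt_of_frame {S : Set E2} {ρ : ℝ} (hρ : 0 < ρ) (hcl : IsClosed S)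
    (hS : ProximalIneq S ρ) (hint : interior S = ∅)
    (hacc : ∀ a ∈ S, ∀ η > 0, ∃ b ∈ S, b ≠ a ∧ dist b a < η)
    {p : E2} (hp : p ∈ S) (e : E2 ≃ᵃⁱ[ℝ] E2) (hep : e p = 0)
    (hflat : ∀ q ∈ S, ‖q - p‖ < ρ → ρ * |e q 1| ≤ ‖q - p‖ ^ 2)
    (hpos : ∀ η > 0, ∃ b ∈ S, 0 < e b 0 ∧ ‖b - p‖ < η) : IsC11GraphAt S p := by
  have hdist : ∀ a b : E2, ‖b - a‖ ^ 2 = (e b 0 - e a 0) ^ 2 + (e b 1 - e a 1) ^ 2 := fun a b => by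
    rw [← dist_eq_norm, ← e.dist_map b a, dist_eq_norm, norm_sq_eq_add]; simp
  have hlt : ∀ a b : E2, (e b 0 - e a 0) ^ 2 + (e b 1 - e a 1) ^ 2 < ρ ^ 2 → ‖b - a‖ < ρ :=
    fun a b h => lt_of_pow_lt_pow_left₀ 2 hρ.le (by rwa [hdist])
  have hinner : ∀ n a b : E2, inner ℝ n (b - a) = e.linearIsometryEquiv n 0 * (e b 0 - e a 0) +
      e.linearIsometryEquiv n 1 * (e b 1 - e a 1) := fun n a b => by
    rw [← e.linearIsometryEquiv.inner_map_map, ← vsub_eq_sub, e.map_vsub, vsub_eq_sub,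
      PiLp.inner_apply, Fin.sum_univ_two]
    simp; ring
  have hep0 : e p 0 = 0 := by rw [hep]; rfl
  have hep1 : e p 1 = 0 := by rw [hep]; rfl
  set T : Set (ℝ × ℝ) := {x | e.symm (pt x.1 x.2) ∈ S} with hT
  have hTcl : IsClosed T := hcl.preimage (e.symm.continuous.comp continuous_pt)
  have hTS : ∀ q ∈ S, (e q 0, e q 1) ∈ T := fun q hq => by
    simpa [hT, pt_eta] using hq
  have hTex : ∀ x ∈ T, ∃ q ∈ S, e q 0 = x.1 ∧ e q 1 = x.2 := fun x hx =>
    ⟨_, hx, by simp [pt_zero], by simp [pt_one]⟩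
  have h0T : (0 : ℝ × ℝ) ∈ T := by
    have := hTS p hp
    rwa [hep0, hep1] at this
  obtain ⟨U, g, I, hU, h0U, hI, hg, hg', hgr⟩ : ∃ (U : Set (ℝ × ℝ)) (g : ℝ → ℝ) (I : Set ℝ),
      IsOpen U ∧ (0 : ℝ × ℝ) ∈ U ∧
      ((∃ a b : ℝ, a < b ∧ I = Set.Ioo a b) ∨ (∃ a b : ℝ, a < b ∧ I = Set.Ico a b)) ∧
      ContDiff ℝ 1 g ∧ (∃ K : NNReal, LipschitzWith K (deriv g)) ∧
      ∀ q : ℝ × ℝ, q ∈ T ∩ U ↔ q.1 ∈ I ∧ q.2 = g q.1 := by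
    refine exists_graph_of_flat hρ hTcl ?_ ?_ h0T ?_ ?_
    · intro x hx
      obtain ⟨a, ha, ha0, ha1⟩ := hTex x hx
      obtain ⟨n, hn, hnb⟩ := hS.exists_tangent_line hρ hcl hint ha (hacc a ha)
      refine ⟨e.linearIsometryEquiv n 0, e.linearIsometryEquiv n 1, ?_, fun y hy hxy => ?_⟩
      · rw [← norm_sq_eq_add, LinearIsometryEquiv.norm_map, hn, one_pow]
      · obtain ⟨b, hb, hb0, hb1⟩ := hTex y hy
        rw [← ha0, ← ha1, ← hb0, ← hb1] at hxy ⊢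
        have := hnb b hb (hlt a b hxy)
        rwa [le_div_iff₀ hρ, hdist, hinner, mul_comm] at this
    · intro x hx y hy hxy
      obtain ⟨a, ha, ha0, ha1⟩ := hTex x hx
      obtain ⟨b, hb, hb0, hb1⟩ := hTex y hy
      rw [← ha0, ← ha1, ← hb0, ← hb1] at hxy ⊢
      have h := hS.infDist_segment_le hcl ha hb (hlt a b hxy) (l := 2⁻¹)
        ⟨by norm_num, by norm_num⟩
      set m := a + (2⁻¹ : ℝ) • (b - a) with hm
      obtain ⟨q, hq, hqm⟩ := hcl.exists_infDist_eq_dist ⟨a, ha⟩ m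
      have hmid : e m = e a + (2⁻¹ : ℝ) • (e b - e a) := by
        have e1 : m = (2⁻¹ : ℝ) • (b - a) +ᵥ a := by rw [hm, vadd_eq_add, add_comm]
        rw [e1, e.map_vadd, LinearIsometryEquiv.map_smul, ← vsub_eq_sub b, e.map_vsub,
          vadd_eq_add, add_comm, vsub_eq_sub]
      have hm0 : e m 0 = (e a 0 + e b 0) / 2 := by rw [hmid]; simp; ring
      have hm1 : e m 1 = (e a 1 + e b 1) / 2 := by rw [hmid]; simp; ring
      rw [hqm, dist_comm, dist_eq_norm] at h
      have h2 : 2 * ρ * ‖q - m‖ ≤ ‖b - a‖ ^ 2 := by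
        have e2 : 2⁻¹ * (‖b - a‖ ^ 2 / ρ) = ‖b - a‖ ^ 2 / (2 * ρ) := by
          field_simp
        rw [e2, le_div_iff₀ (by positivity)] at h
        linarith
      have hd := hdist m q
      have hq0 : |e q 0 - e m 0| ≤ ‖q - m‖ := by
        refine abs_le_of_sq_le_sq ?_ (norm_nonneg _)
        nlinarith [sq_nonneg (e q 1 - e m 1)]
      have hq1 : |e q 1 - e m 1| ≤ ‖q - m‖ := by
        refine abs_le_of_sq_le_sq ?_ (norm_nonneg _)
        nlinarith [sq_nonneg (e q 0 - e m 0)]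
      refine ⟨_, hTS q hq, ?_, ?_⟩
      · rw [← hm0, ← hdist]
        exact (mul_le_mul_of_nonneg_left hq0 (by positivity)).trans h2
      · rw [← hm1, ← hdist]
        exact (mul_le_mul_of_nonneg_left hq1 (by positivity)).trans h2
    · intro y hy hlt'
      obtain ⟨b, hb, hb0, hb1⟩ := hTex y hy
      have hd := hdist p b
      rw [hep0, hep1, sub_zero, sub_zero] at hd
      rw [← hb0, ← hb1, ← hd] at hlt' ⊢
      exact hflat b hb (lt_of_pow_lt_pow_left₀ 2 hρ.le hlt')
    · intro η hη
      obtain ⟨b, hb, hb0, hbp⟩ := hpos η hη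
      have hd := hdist p b
      rw [hep0, hep1, sub_zero, sub_zero] at hd
      refine ⟨_, hTS b hb, hb0, ?_, ?_⟩
      · refine lt_of_le_of_lt (le_of_sq_le_sq ?_ (norm_nonneg _)) hbp
        nlinarith [sq_nonneg (e b 1)]
      · refine lt_of_le_of_lt (abs_le_of_sq_le_sq ?_ (norm_nonneg _)) hbp
        nlinarith [sq_nonneg (e b 0)]
  refine ⟨e, {q | (e q 0, e q 1) ∈ U}, g, I, ?_, ?_, hI, hg, hg', ?_⟩
  · have : Continuous fun q : E2 => (e q 0, e q 1) := by
      have := e.continuous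
      fun_prop
    exact hU.preimage this
  · change (e p 0, e p 1) ∈ U
    rw [hep0, hep1]; exact h0U
  · ext z
    constructor
    · rintro ⟨q, ⟨hqS, hqU⟩, rfl⟩
      obtain ⟨h1, h2⟩ := (hgr _).1 ⟨hTS q hqS, hqU⟩
      refine ⟨e q 0, h1, ?_⟩
      change pt (e q 0) (g (e q 0)) = e q
      rw [← h2]
      exact pt_eta _
    · rintro ⟨t, ht, rfl⟩
      obtain ⟨h1, h2⟩ := (hgr (t, g t)).2 ⟨ht, rfl⟩
      refine ⟨e.symm (pt t (g t)), ⟨h1, ?_⟩, by simp⟩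
      simpa [pt_zero, pt_one] using h2

theorem ProximalIneq.isC11GraphAt {S : Set E2} {ρ : ℝ} (hρ : 0 < ρ) (hcl : IsClosed S)
    (hS : ProximalIneq S ρ) (hint : interior S = ∅)
    (hacc : ∀ a ∈ S, ∀ η > 0, ∃ b ∈ S, b ≠ a ∧ dist b a < η)
    {p : E2} (hp : p ∈ S) : IsC11GraphAt S p := by
  obtain ⟨n, hn, hnb⟩ := hS.exists_tangent_line hρ hcl hint hp (hacc p hp)
  set τ : E2 := !₂[n 1, -n 0] with hτ
  have hτ1 : ‖τ‖ = 1 := by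
    have h1 := norm_sq_eq_add τ
    have h2 := norm_sq_eq_add n
    have h3 : ‖τ‖ ^ 2 = 1 := by
      rw [h1, ← one_pow (M := ℝ) 2, ← hn, h2, hτ]; simp; ring
    exact (pow_eq_one_iff_of_nonneg (norm_nonneg τ) two_ne_zero).1 h3
  have hτn : inner ℝ τ n = 0 := by
    simp [PiLp.inner_apply, Fin.sum_univ_two, hτ]; ring
  obtain ⟨e₁, he₁⟩ := exists_rigid_motion p hτ1 hn hτn
  obtain ⟨e₂, he₂⟩ := exists_rigid_motion p (τ := -τ) (by rwa [norm_neg]) hn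
    (by rw [inner_neg_left, hτn, neg_zero])
  have horigin : ∀ (e : E2 ≃ᵃⁱ[ℝ] E2) (σ : E2),
      (∀ q, e q 0 = inner ℝ σ (q - p) ∧ e q 1 = inner ℝ n (q - p)) → e p = 0 := by
    intro e σ he
    have := he p
    rw [sub_self, inner_zero_right, inner_zero_right] at this
    ext i; fin_cases i
    · exact this.1
    · exact this.2
  have hflat : ∀ q ∈ S, ‖q - p‖ < ρ → ρ * |inner ℝ n (q - p)| ≤ ‖q - p‖ ^ 2 := fun q hq hlt => by
    have := hnb q hq hlt
    rwa [le_div_iff₀ hρ, mul_comm] at this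
  by_cases hside : ∀ η > 0, ∃ b ∈ S, 0 < e₁ b 0 ∧ ‖b - p‖ < η
  · exact hS.isC11GraphAt_of_frame hρ hcl hint hacc hp e₁ (horigin e₁ _ he₁)
      (fun q hq hlt => by rw [(he₁ q).2]; exact hflat q hq hlt) hside
  refine hS.isC11GraphAt_of_frame hρ hcl hint hacc hp e₂ (horigin e₂ _ he₂)
    (fun q hq hlt => by rw [(he₂ q).2]; exact hflat q hq hlt) fun η hη => ?_
  push Not at hside
  obtain ⟨η₀, hη₀, hside⟩ := hside
  obtain ⟨b, hb, hbp, hlt⟩ := hacc p hp (min η (min η₀ ρ)) (lt_min hη (lt_min hη₀ hρ))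
  rw [dist_eq_norm, lt_min_iff, lt_min_iff] at hlt
  obtain ⟨hltη, hltη₀, hltρ⟩ := hlt
  refine ⟨b, hb, ?_, hltη⟩
  have hle : e₁ b 0 ≤ 0 := not_lt.1 fun h => absurd (hside b hb h) (not_le.2 hltη₀)
  have hneg : e₂ b 0 = - e₁ b 0 := by rw [(he₁ b).1, (he₂ b).1, inner_neg_left]
  refine lt_of_le_of_ne (by rw [hneg]; linarith) fun h0 => hbp ?_
  have hx : e₁ b 0 = 0 := by rw [hneg] at h0; linarith
  have hnorm : ‖b - p‖ ^ 2 = e₁ b 1 ^ 2 := by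
    rw [← dist_eq_norm, ← e₁.dist_map b p, horigin e₁ _ he₁, dist_zero_right, norm_sq_eq_add, hx]
    ring
  have habs : |e₁ b 1| = ‖b - p‖ := by
    rw [← abs_norm (b - p)]; exact (sq_eq_sq_iff_abs_eq_abs _ _).1 hnorm.symm
  have hf := hflat b hb hltρ
  rw [← (he₁ b).2, habs] at hf
  have : ‖b - p‖ ≤ 0 := by
    by_contra! hpos
    nlinarith
  exact sub_eq_zero.1 (norm_le_zero_iff.1 this)

/-- **Theorem (characterization of planar proximally `C¹` sets with empty interior).**
If `S ⊆ ℝ²` is nonempty, closed, connected, has empty interior, and is proximally `C¹`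
of some radius `r_S > 0` (i.e. the distance function from `S` is `C¹` on
`{0 < d_S < r_S}`), then `S` is either a singleton or a `1`-dimensional manifold
(possibly with boundary) of class `C^{1,1}`. -/
theorem stmt0 (S : Set E2) (rS : ℝ) (hrS : 0 < rS)
    (hne : S.Nonempty) (hcl : IsClosed S) (hconn : IsConnected S)
    (hint : interior S = ∅)
    (hprox : ContDiffOn ℝ 1 (fun x => infDist x S)
      {x | 0 < infDist x S ∧ infDist x S < rS}) :
    (∃ p, S = {p}) ∨ (∀ p ∈ S, IsC11GraphAt S p) := by
  rcases S.subsingleton_or_nontrivial with hsub | hnt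
  · obtain ⟨p, hp⟩ := hne
    exact Or.inl ⟨p, hsub.eq_singleton_of_mem hp⟩
  right
  have hopen : IsOpen {x | 0 < infDist x S ∧ infDist x S < rS} :=
    (isOpen_lt continuous_const (continuous_infDist_pt S)).inter
      (isOpen_lt (continuous_infDist_pt S) continuous_const)
  have hdiff : ∀ y, 0 < infDist y S → infDist y S < rS →
      DifferentiableAt ℝ (fun x => infDist x S) y := fun y h0 hr =>
    (hprox.differentiableOn one_ne_zero).differentiableAt (hopen.mem_nhds ⟨h0, hr⟩)
  have hacc : ∀ a ∈ S, ∀ η > 0, ∃ b ∈ S, b ≠ a ∧ dist b a < η := fun a ha η hη => by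
    obtain ⟨b, ⟨hbη, hb⟩, hba⟩ := preperfect_iff_nhds.1
      (hconn.isPreconnected.preperfect_of_nontrivial hnt) a ha _ (ball_mem_nhds a hη)
    exact ⟨b, hb, hba, hbη⟩
  exact fun p hp => (proximalIneq_of_differentiable hne hcl (half_lt_self hrS) hdiff).isC11GraphAt
    (half_pos hrS) hcl hint hacc hp
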